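/- Assume the homogeneous permutation relation D₁ R M₁ R = R M₁ R⁻¹ D₁ holds (so that products of the matrices D and M in A are already normally ordered). Set L̂ = MD. Then for all n ≥ 2 and 1 ≤ m ≤ n − 1: D_{⟨m⟩} L̂_{⟨n⟩} = L̂_{⟨n⟩} D_{⟨m⟩} · J_{n−m}^{↑m} · (J_{n−m+1}^{↑(m−1)})⁻¹, where J_s^{↑p} = R_{(p+s−1)→(p+1)} R_{(p+1)→(p+s−1)} is the Jucys–Murphy matrix shifted by p positions (J₁^{↑p} = I and J_s^{↑0} = J_s). In the quantum double this identity gives the normally ordered form :D_{⟨m⟩} L̂_{⟨n⟩}:. -/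

import Mathlib

open scoped BigOperators

noncomputable section

/-- One-site embedding of an `N×N` matrix into `Mat_{N^k}` at 0-based position `i`
(the paper's `X_{i+1}` in 1-based numbering).  Out of range we return the identity. -/
def matAt {α : Type*} [Semiring α] (N k : ℕ) (X : Matrix (Fin N) (Fin N) α) (i : ℕ) :
    Matrix (Fin k → Fin N) (Fin k → Fin N) α :=
  if h : i < k then
    Matrix.of fun a b =>
      if ∀ l : Fin k, (l : ℕ) ≠ i → a l = b l then X (a ⟨i, h⟩) (b ⟨i, h⟩) else 0
  else 1

/-- Two-site embedding of an operator on `V⊗V` into `Mat_{N^k}` at 0-based positions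
`i, i+1` (the paper's `R_{i+1}` in 1-based numbering). -/
def opAt {α : Type*} [Semiring α] (N k : ℕ)
    (R : Matrix (Fin N × Fin N) (Fin N × Fin N) α) (i : ℕ) :
    Matrix (Fin k → Fin N) (Fin k → Fin N) α :=
  if h : i + 1 < k then
    Matrix.of fun a b =>
      if ∀ l : Fin k, (l : ℕ) ≠ i → (l : ℕ) ≠ i + 1 → a l = b l then
        R (a ⟨i, by omega⟩, a ⟨i + 1, h⟩) (b ⟨i, by omega⟩, b ⟨i + 1, h⟩)
      else 0
  else 1

/-- A numeric (complex) matrix viewed inside `Mat(A)` via the unit of `A`. -/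
def toA (A : Type*) [Semiring A] [Algebra ℂ A] {ι : Type*} (X : Matrix ι ι ℂ) :
    Matrix ι ι A :=
  X.map (algebraMap ℂ A)

/-- The braid relation `R₁R₂R₁ = R₂R₁R₂` on `V^{⊗3}`. -/
def IsBraid (N : ℕ) (R : Matrix (Fin N × Fin N) (Fin N × Fin N) ℂ) : Prop :=
  opAt N 3 R 0 * opAt N 3 R 1 * opAt N 3 R 0 = opAt N 3 R 1 * opAt N 3 R 0 * opAt N 3 R 1

/-- The Hecke condition `(q·I − R)(q⁻¹·I + R) = 0`. -/
def IsHecke (N : ℕ) (q : ℂ) (R : Matrix (Fin N × Fin N) (Fin N × Fin N) ℂ) : Prop :=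
  (q • (1 : Matrix (Fin N × Fin N) (Fin N × Fin N) ℂ) - R) * (q⁻¹ • 1 + R) = 0

/-- `q` is generic: `q ∉ {0, 1, −1}` and `qⁿ ≠ 1` for all positive integers `n`. -/
def GenericQ (q : ℂ) : Prop :=
  q ≠ 0 ∧ q ≠ 1 ∧ q ≠ -1 ∧ ∀ n : ℕ, 0 < n → q ^ n ≠ 1

/-- The reflection-equation type relation `R X₁ R X₁ = X₁ R X₁ R` in `Mat_{N²}`. -/
def RErel {α : Type*} [Semiring α] (N : ℕ)
    (R : Matrix (Fin N × Fin N) (Fin N × Fin N) α) (X : Matrix (Fin N) (Fin N) α) : Prop :=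
  opAt N 2 R 0 * matAt N 2 X 0 * opAt N 2 R 0 * matAt N 2 X 0 =
    matAt N 2 X 0 * opAt N 2 R 0 * matAt N 2 X 0 * opAt N 2 R 0

/-- The quantum-double permutation relation `D₁ R M₁ R = R M₁ R⁻¹ D₁ + R` in `Mat_{N²}(A)`. -/
def PermRel {A : Type*} [Ring A] [Algebra ℂ A] (N : ℕ)
    (R Rinv : Matrix (Fin N × Fin N) (Fin N × Fin N) ℂ)
    (M D : Matrix (Fin N) (Fin N) A) : Prop :=
  matAt N 2 D 0 * opAt N 2 (toA A R) 0 * matAt N 2 M 0 * opAt N 2 (toA A R) 0 =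
    opAt N 2 (toA A R) 0 * matAt N 2 M 0 * opAt N 2 (toA A Rinv) 0 * matAt N 2 D 0 +
      opAt N 2 (toA A R) 0

/-- The homogeneous permutation relation `D₁ R M₁ R = R M₁ R⁻¹ D₁` in `Mat_{N²}(A)`. -/
def PermRelHom {A : Type*} [Ring A] [Algebra ℂ A] (N : ℕ)
    (R Rinv : Matrix (Fin N × Fin N) (Fin N × Fin N) ℂ)
    (M D : Matrix (Fin N) (Fin N) A) : Prop :=
  matAt N 2 D 0 * opAt N 2 (toA A R) 0 * matAt N 2 M 0 * opAt N 2 (toA A R) 0 =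
    opAt N 2 (toA A R) 0 * matAt N 2 M 0 * opAt N 2 (toA A Rinv) 0 * matAt N 2 D 0

/-- Overline copies: `ovCopy … r = X_{⟨r+1⟩}`, i.e. `X_{⟨1⟩} = X⊗I⊗⋯⊗I` and
`X_{⟨r+1⟩} = R_r X_{⟨r⟩} R_r⁻¹`. -/
def ovCopy {α : Type*} [Semiring α] (N k : ℕ)
    (R Rinv : Matrix (Fin N × Fin N) (Fin N × Fin N) α)
    (X : Matrix (Fin N) (Fin N) α) : ℕ → Matrix (Fin k → Fin N) (Fin k → Fin N) α
  | 0 => matAt N k X 0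
  | r + 1 => opAt N k R r * ovCopy N k R Rinv X r * opAt N k Rinv r

/-- Underline copies: `unCopy … r = X_{[r+1]}`, i.e. `X_{[1]} = X⊗I⊗⋯⊗I` and
`X_{[r+1]} = R_r⁻¹ X_{[r]} R_r`. -/
def unCopy {α : Type*} [Semiring α] (N k : ℕ)
    (R Rinv : Matrix (Fin N × Fin N) (Fin N × Fin N) α)
    (X : Matrix (Fin N) (Fin N) α) : ℕ → Matrix (Fin k → Fin N) (Fin k → Fin N) α
  | 0 => matAt N k X 0
  | r + 1 => opAt N k Rinv r * unCopy N k R Rinv X r * opAt N k R r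

/-- `X_{⟨1→n⟩} = X_{⟨1⟩}X_{⟨2⟩}⋯X_{⟨n⟩}`. -/
def ovProd {α : Type*} [Semiring α] (N k : ℕ)
    (R Rinv : Matrix (Fin N × Fin N) (Fin N × Fin N) α)
    (X : Matrix (Fin N) (Fin N) α) (n : ℕ) : Matrix (Fin k → Fin N) (Fin k → Fin N) α :=
  ((List.range n).map (ovCopy N k R Rinv X)).prod

/-- `X_{⟨n→1⟩} = X_{⟨n⟩}X_{⟨n−1⟩}⋯X_{⟨1⟩}`. -/
def ovProdRev {α : Type*} [Semiring α] (N k : ℕ)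
    (R Rinv : Matrix (Fin N × Fin N) (Fin N × Fin N) α)
    (X : Matrix (Fin N) (Fin N) α) (n : ℕ) : Matrix (Fin k → Fin N) (Fin k → Fin N) α :=
  ((List.range n).reverse.map (ovCopy N k R Rinv X)).prod

/-- Shifted Jucys–Murphy matrices: `JMup … R n s = J_{s+1}^{↑n}`, i.e. `J₁^{↑n} = I` and
`J_{s+1}^{↑n} = R_{n+s} J_s^{↑n} R_{n+s}` (paper's 1-based `R_{n+s}` is `opAt … (n+s-1)`).
Applying it to `R⁻¹` produces `(J_{s+1}^{↑n})⁻¹`. -/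
def JMup {α : Type*} [Semiring α] (N k : ℕ)
    (R : Matrix (Fin N × Fin N) (Fin N × Fin N) α) (n : ℕ) :
    ℕ → Matrix (Fin k → Fin N) (Fin k → Fin N) α
  | 0 => 1
  | s + 1 => opAt N k R (n + s) * JMup N k R n s * opAt N k R (n + s)

/-- The quantum trace `Tr_{R(1…n)}(X) = Tr(C₁C₂⋯C_n X)`. -/
def qTr {α : Type*} [Semiring α] (N n : ℕ) (C : Matrix (Fin N) (Fin N) α)
    (X : Matrix (Fin n → Fin N) (Fin n → Fin N) α) : α :=
  Matrix.trace (((List.range n).map (matAt N n C)).prod * X)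

/-- The matrix `C`, `C_i^j = Σ_k Ψ_{ik}^{jk}`. -/
def traceMat (N : ℕ) (Ψ : Matrix (Fin N × Fin N) (Fin N × Fin N) ℂ) :
    Matrix (Fin N) (Fin N) ℂ :=
  Matrix.of fun i j => ∑ k, Ψ (i, k) (j, k)

/-- Skew-invertibility of `R`: `Tr₂(R₁₂Ψ₂₃) = Tr₂(Ψ₁₂R₂₃) = P₁₃`, written componentwise. -/
def SkewInv (N : ℕ) (R Ψ : Matrix (Fin N × Fin N) (Fin N × Fin N) ℂ) : Prop :=
  (∀ i k l n : Fin N, ∑ j, ∑ b, R (i, j) (l, b) * Ψ (b, k) (j, n) =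
      if i = n ∧ k = l then 1 else 0) ∧
  (∀ i k l n : Fin N, ∑ j, ∑ b, Ψ (i, j) (l, b) * R (b, k) (j, n) =
      if i = n ∧ k = l then 1 else 0)

/-- The generators `R₁, …, R_{n−1}` (1-based) of the Hecke-algebra image inside
`End(V^{⊗k})`, as a subset of `Mat_{N^k}`. -/
def genSet {α : Type*} [Semiring α] (N k n : ℕ)
    (R : Matrix (Fin N × Fin N) (Fin N × Fin N) α) :
    Set (Matrix (Fin k → Fin N) (Fin k → Fin N) α) :=
  {X | ∃ i : ℕ, i + 1 < n ∧ X = opAt N k R i}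

/-- The left ideal of `A` generated by the entries of `D`. -/
def entryIdeal (A : Type*) [Ring A] {N : ℕ} (D : Matrix (Fin N) (Fin N) A) :
    Submodule A A :=
  Submodule.span A {x : A | ∃ i j : Fin N, x = D i j}

/-- The normally ordered monomial `:L̂_{⟨1→k⟩}: = M_{⟨1→k⟩} D_{⟨k→1⟩} ∏_{s=1}^{k} J_s⁻¹`. -/
def normOrd {α : Type*} [Semiring α] (N k : ℕ)
    (R Rinv : Matrix (Fin N × Fin N) (Fin N × Fin N) α)
    (M D : Matrix (Fin N) (Fin N) α) (n : ℕ) :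
    Matrix (Fin k → Fin N) (Fin k → Fin N) α :=
  ovProd N k R Rinv M n * ovProdRev N k R Rinv D n *
    ((List.range n).map (fun s => JMup N k Rinv 0 s)).prod

/-- The relation `D_{⟨1⟩} L_{⟨2⟩} = L_{⟨2⟩} D_{⟨1⟩} R₁⁻²` for `L = M D`, in an arbitrary monoid. -/
theorem mul_conj_mul_of_perm {S : Type*} [Monoid S] (r : Sˣ) (M D : S)
    (hD : ↑r⁻¹ * D * ↑r⁻¹ * D = D * ↑r⁻¹ * D * (↑r⁻¹ : S))
    (hDM : D * r * M * r = r * M * ↑r⁻¹ * D) :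
    D * (r * (M * D) * ↑r⁻¹) = r * (M * D) * ↑r⁻¹ * D * ↑r⁻¹ * ↑r⁻¹ := by
  have h : D * r * M = r * M * ↑r⁻¹ * D * ↑r⁻¹ := by
    rw [← hDM, Units.mul_inv_cancel_right]
  calc D * (r * (M * D) * ↑r⁻¹) = D * r * M * D * ↑r⁻¹ := by simp only [mul_assoc]
    _ = r * M * (↑r⁻¹ * D * ↑r⁻¹ * D) * ↑r⁻¹ := by rw [h]; simp only [mul_assoc]
    _ = _ := by rw [hD]; simp only [mul_assoc]

section Conjugates

variable {S : Type*} [Monoid S] {r : ℕ → Sˣ} {X : ℕ → S}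

theorem semiconjBy_copy (hX : ∀ s, X (s + 1) = r s * X s * ↑(r s)⁻¹) (s : ℕ) :
    SemiconjBy (r s : S) (X s) (X (s + 1)) := by
  rw [SemiconjBy, hX, Units.inv_mul_cancel_right]

theorem commute_copy_of_lt (hfar : ∀ i j, i + 2 ≤ j → Commute (r i : S) (r j))
    (hX : ∀ s, X (s + 1) = r s * X s * ↑(r s)⁻¹)
    (hX0 : ∀ i, 1 ≤ i → Commute (r i : S) (X 0)) (s i : ℕ) (h : s < i) :
    Commute (r i : S) (X s) := by
  induction s with
  | zero => exact hX0 i h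
  | succ s ih =>
    have hc := (hfar s i (by omega)).symm
    rw [hX]
    exact (hc.mul_right (ih (by omega))).mul_right hc.units_inv_right

theorem commute_copy_add_two {p : ℕ}
    (hbraid : (r p * r (p + 1) * r p : S) = r (p + 1) * r p * r (p + 1))
    (hX : ∀ s, X (s + 1) = r s * X s * ↑(r s)⁻¹)
    (hc : Commute (r (p + 1) : S) (X p)) :
    Commute (r p : S) (X (p + 2)) := by
  have h1 : SemiconjBy ((r (p + 1) * r p : Sˣ) : S) (X p) (X (p + 2)) := by
    rw [Units.val_mul]
    exact (semiconjBy_copy hX (p + 1)).mul_left (semiconjBy_copy hX p)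
  have h2 : SemiconjBy ((r (p + 1) * r p : Sˣ) : S) (r (p + 1)) (r p) := by
    rw [SemiconjBy, Units.val_mul, ← hbraid, mul_assoc]
  have h3 := h2.mul_right h1
  rw [hc.eq] at h3
  exact (Units.mul_left_inj _).1 (h3.eq.symm.trans (h1.mul_right h2).eq)

theorem semiconjBy_braid {p : ℕ}
    (hbraid : (r p * r (p + 1) * r p : S) = r (p + 1) * r p * r (p + 1)) :
    SemiconjBy ((r p * r (p + 1) : Sˣ) : S) (r p) (r (p + 1)) := by
  rw [SemiconjBy, Units.val_mul, hbraid, mul_assoc]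

variable {D L : ℕ → S} {k : ℕ}

/-- Adjacent copies satisfy the same exchange relation as the first two. -/
theorem copy_mul_copy_succ (hfar : ∀ i j, i + 2 ≤ j → Commute (r i : S) (r j))
    (hbraid : ∀ p, p + 2 < k → (r p * r (p + 1) * r p : S) = r (p + 1) * r p * r (p + 1))
    (hD : ∀ s, D (s + 1) = r s * D s * ↑(r s)⁻¹)
    (hD0 : ∀ i, 1 ≤ i → Commute (r i : S) (D 0))
    (hL : ∀ s, L (s + 1) = r s * L s * ↑(r s)⁻¹)
    (hL0 : ∀ i, 1 ≤ i → Commute (r i : S) (L 0))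
    (hDL : D 0 * L 1 = L 1 * D 0 * ↑(r 0)⁻¹ * ↑(r 0)⁻¹) (p : ℕ) (hp : p + 1 < k) :
    D p * L (p + 1) = L (p + 1) * D p * ↑(r p)⁻¹ * ↑(r p)⁻¹ := by
  induction p with
  | zero => exact hDL
  | succ p ih =>
    have hb := hbraid p (by omega)
    have hDs : SemiconjBy ((r p * r (p + 1) : Sˣ) : S) (D p) (D (p + 1)) := by
      rw [Units.val_mul]
      exact (semiconjBy_copy hD p).mul_left
        (commute_copy_of_lt hfar hD hD0 p (p + 1) (by omega))
    have hLs : SemiconjBy ((r p * r (p + 1) : Sˣ) : S) (L (p + 1)) (L (p + 2)) := by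
      rw [Units.val_mul]
      have hc : Commute (r p : S) (L (p + 2)) := commute_copy_add_two hb hL
        (commute_copy_of_lt hfar hL hL0 p (p + 1) (by omega))
      exact SemiconjBy.mul_left hc (semiconjBy_copy hL (p + 1))
    have hrs : SemiconjBy ((r p * r (p + 1) : Sˣ) : S) ↑(r p)⁻¹ ↑(r (p + 1))⁻¹ :=
      (semiconjBy_braid hb).units_inv_right
    have h1 := hDs.mul_right hLs
    rw [ih (by omega)] at h1
    exact (Units.mul_left_inj _).1
      (h1.eq.symm.trans (((hLs.mul_right hDs).mul_right hrs).mul_right hrs).eq)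

/-- Exchange relation for two arbitrary copies; `J` and `J'` play the roles of the shifted
Jucys–Murphy elements `J_{n-m}^{↑m}` and `(J_{n-m+1}^{↑(m-1)})⁻¹`. -/
theorem copy_mul_copy (hfar : ∀ i j, i + 2 ≤ j → Commute (r i : S) (r j))
    (hbraid : ∀ p, p + 2 < k → (r p * r (p + 1) * r p : S) = r (p + 1) * r p * r (p + 1))
    (hD : ∀ s, D (s + 1) = r s * D s * ↑(r s)⁻¹)
    (hD0 : ∀ i, 1 ≤ i → Commute (r i : S) (D 0))
    (hL : ∀ s, L (s + 1) = r s * L s * ↑(r s)⁻¹)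
    (hL0 : ∀ i, 1 ≤ i → Commute (r i : S) (L 0))
    (hDL : D 0 * L 1 = L 1 * D 0 * ↑(r 0)⁻¹ * ↑(r 0)⁻¹) (p : ℕ) (J J' : ℕ → S)
    (hJ0 : J 0 = 1) (hJ : ∀ t, J (t + 1) = r (p + 1 + t) * J t * r (p + 1 + t))
    (hJ'0 : J' 0 = 1) (hJ' : ∀ t, J' (t + 1) = ↑(r (p + t))⁻¹ * J' t * ↑(r (p + t))⁻¹)
    (t : ℕ) (hp : p + t + 1 < k) :
    D p * L (p + t + 1) = L (p + t + 1) * D p * J t * J' (t + 1) := by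
  induction t with
  | zero =>
    have h := copy_mul_copy_succ hfar hbraid hD hD0 hL hL0 hDL p hp
    simpa [hJ0, hJ', hJ'0, mul_assoc] using h
  | succ t ih =>
    have e : p + 1 + t = p + t + 1 := by omega
    have hc : Commute (r (p + t + 1) : S) (D p) :=
      commute_copy_of_lt hfar hD hD0 p (p + t + 1) (by omega)
    have hs : SemiconjBy (r (p + t + 1) : S) (L (p + t + 1)) (L (p + t + 2)) :=
      semiconjBy_copy hL _
    have hK : SemiconjBy (r (p + t + 1) : S) (J t * J' (t + 1)) (J (t + 1) * J' (t + 2)) := by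
      rw [SemiconjBy, hJ, hJ' (t + 1), e, ← add_assoc]
      simp only [mul_assoc, Units.mul_inv_cancel_left, Units.inv_mul, mul_one]
    have h1 := SemiconjBy.mul_right hc hs
    rw [ih (by omega), mul_assoc (_ * _)] at h1
    have h2 := (hs.mul_right hc).mul_right hK
    have h3 := (Units.mul_left_inj _).1 (h1.eq.symm.trans h2.eq)
    rw [mul_assoc (_ * _)]
    exact h3

end Conjugates

section Embedding

open Classical in
/-- The matrix on `κ → n` that acts as `X` on the tensor factors `f i`, `i : ι`, and as the
identity on the remaining ones. -/
def embedAt {ι κ n α : Type*} [Semiring α] (f : ι → κ) (X : Matrix (ι → n) (ι → n) α) :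
    Matrix (κ → n) (κ → n) α :=
  Matrix.of fun a b => if ∀ l ∉ Set.range f, a l = b l then X (a ∘ f) (b ∘ f) else 0

variable {ι ι' κ n α : Type*} [Semiring α]

theorem embedAt_comp (f : ι → κ) (hf : f.Injective) (g : ι' → ι)
    (X : Matrix (ι' → n) (ι' → n) α) :
    embedAt f (embedAt g X) = embedAt (f ∘ g) X := by
  ext a b
  simp only [embedAt, Matrix.of_apply]
  have : (∀ l ∉ Set.range (f ∘ g), a l = b l) ↔
      (∀ l ∉ Set.range f, a l = b l) ∧ ∀ i ∉ Set.range g, (a ∘ f) i = (b ∘ f) i := by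
    constructor
    · refine fun h => ⟨fun l hl => h l fun ⟨x, hx⟩ => hl ⟨g x, hx⟩, fun i hi => h (f i) ?_⟩
      rintro ⟨x, hx⟩
      exact hi ⟨x, hf hx⟩
    · rintro ⟨h1, h2⟩ l hl
      by_cases hlf : l ∈ Set.range f
      · obtain ⟨i, rfl⟩ := hlf
        exact h2 i fun ⟨x, hx⟩ => hl ⟨x, congrArg f hx⟩
      · exact h1 l hlf
  by_cases h1 : ∀ l ∉ Set.range f, a l = b l
  · rw [if_pos h1]
    congr 1
    exact propext ⟨fun h => this.2 ⟨h1, h⟩, fun h => (this.1 h).2⟩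
  · rw [if_neg h1, if_neg fun h => h1 (this.1 h).1]

theorem embedAt_one [DecidableEq n] [Fintype ι] [Fintype κ] (f : ι → κ) :
    embedAt f (1 : Matrix (ι → n) (ι → n) α) = 1 := by
  ext a b
  simp only [embedAt, Matrix.of_apply, Matrix.one_apply]
  by_cases hab : a = b
  · simp [hab]
  · rw [if_neg hab]
    split_ifs with h1 h2
    · refine absurd (funext fun l => ?_) hab
      by_cases hl : l ∈ Set.range f
      · obtain ⟨i, rfl⟩ := hl
        exact congrFun h2 i
      · exact h1 l hl
    · rfl
    · rfl

variable [Fintype n] [Fintype κ] [DecidableEq κ]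

theorem embedAt_mul [Fintype ι] [DecidableEq ι] (f : ι → κ) (hf : f.Injective) (X Y : Matrix (ι → n) (ι → n) α) :
    embedAt f (X * Y) = embedAt f X * embedAt f Y := by
  ext a b
  rw [Matrix.mul_apply]
  simp only [embedAt, Matrix.of_apply]
  split_ifs with hab
  · rw [Matrix.mul_apply]
    refine Fintype.sum_of_injective (fun d : ι → n => Function.extend f d a) ?_ _ _ ?_ ?_
    · intro d d' h
      funext i
      simpa [hf.extend_apply] using congrFun h (f i)
    · intro c hc
      rw [if_neg, zero_mul]
      intro h
      refine hc ⟨c ∘ f, funext fun l => ?_⟩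
      by_cases hl : l ∈ Set.range f
      · obtain ⟨i, rfl⟩ := hl
        simp [hf.extend_apply]
      · simpa [Function.extend_apply' _ _ _ hl] using h l hl
    · intro d
      have hd : Function.extend f d a ∘ f = d := funext fun i => hf.extend_apply _ _ _
      have h : ∀ l ∉ Set.range f, Function.extend f d a l = a l := fun l hl =>
        Function.extend_apply' _ _ _ hl
      rw [if_pos fun l hl => (h l hl).symm, if_pos fun l hl => (h l hl).trans (hab l hl), hd]
  · refine (Finset.sum_eq_zero fun c _ => ?_).symm
    split_ifs with h1 h2
    · exact absurd (fun l hl => (h1 l hl).trans (h2 l hl)) hab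
    all_goals simp

theorem embedAt_mul_embedAt_apply (f : ι → κ) (g : ι' → κ)
    (hfg : Disjoint (Set.range f) (Set.range g))
    (X : Matrix (ι → n) (ι → n) α) (Y : Matrix (ι' → n) (ι' → n) α) (a b : κ → n)
    [Decidable (∀ l, l ∉ Set.range f → l ∉ Set.range g → a l = b l)] :
    (embedAt f X * embedAt g Y) a b =
      if ∀ l, l ∉ Set.range f → l ∉ Set.range g → a l = b l then
        X (a ∘ f) (b ∘ f) * Y (a ∘ g) (b ∘ g) else 0 := by
  classical
  rw [Matrix.mul_apply]
  simp only [embedAt, Matrix.of_apply]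
  let c : κ → n := fun l => if l ∈ Set.range f then b l else a l
  rw [Finset.sum_eq_single c]
  · have hcf : c ∘ f = b ∘ f := funext fun i => if_pos ⟨i, rfl⟩
    have hcg : c ∘ g = a ∘ g := funext fun i =>
      if_neg fun h => Set.disjoint_left.1 hfg h ⟨i, rfl⟩
    have h1 : ∀ l ∉ Set.range f, a l = c l := fun l hl => (if_neg hl).symm
    rw [if_pos h1, hcf, hcg]
    have h2 : (∀ l ∉ Set.range g, c l = b l) ↔
        ∀ l, l ∉ Set.range f → l ∉ Set.range g → a l = b l := by
      constructor
      · exact fun h l hf hg => (h1 l hf).trans (h l hg)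
      · intro h l hg
        by_cases hf : l ∈ Set.range f
        · exact if_pos hf
        · exact (if_neg hf).trans (h l hf hg)
    simp only [h2]
    split_ifs <;> simp
  · intro d _ hd
    split_ifs with h1 h2
    · refine absurd (funext fun l => ?_) hd
      by_cases hf : l ∈ Set.range f
      · exact (h2 l (Set.disjoint_left.1 hfg hf)).trans (if_pos hf).symm
      · exact (h1 l hf).symm.trans (if_neg hf).symm
    all_goals simp
  · simp

theorem commute_embedAt (f : ι → κ) (g : ι' → κ)
    (hfg : Disjoint (Set.range f) (Set.range g))
    (X : Matrix (ι → n) (ι → n) α) (Y : Matrix (ι' → n) (ι' → n) α)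
    (hXY : ∀ a b c d, Commute (X a b) (Y c d)) :
    Commute (embedAt f X) (embedAt g Y) := by
  classical
  ext a b
  rw [embedAt_mul_embedAt_apply f g hfg, embedAt_mul_embedAt_apply g f hfg.symm, (hXY _ _ _ _).eq]
  refine if_congr ⟨fun h l h1 h2 => h l h2 h1, fun h l h1 h2 => h l h2 h1⟩ rfl rfl

end Embedding

section Sites

variable {α : Type*} [Semiring α] {N k : ℕ}

theorem matAt_eq_embedAt (X : Matrix (Fin N) (Fin N) α) (i : ℕ) (h : i < k) :
    matAt N k X i = embedAt (fun _ : Fin 1 => (⟨i, h⟩ : Fin k))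
      (X.submatrix (fun a => a 0) fun a => a 0) := by
  ext a b
  simp only [matAt, dif_pos h, embedAt, Matrix.of_apply, Matrix.submatrix_apply,
    Function.comp_apply]
  congr 1
  refine propext (forall_congr' fun l => ?_)
  simp [Fin.ext_iff, eq_comm]

theorem opAt_eq_embedAt (R : Matrix (Fin N × Fin N) (Fin N × Fin N) α) (i : ℕ)
    (h : i + 1 < k) :
    opAt N k R i = embedAt ![(⟨i, by omega⟩ : Fin k), ⟨i + 1, h⟩]
      (R.submatrix (finTwoArrowEquiv _) (finTwoArrowEquiv _)) := by
  ext a b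
  simp only [opAt, dif_pos h, embedAt, Matrix.of_apply, Matrix.submatrix_apply,
    finTwoArrowEquiv_apply]
  congr 1
  refine propext (forall_congr' fun l => ?_)
  simp only [Matrix.range_cons, Matrix.range_empty, Set.union_empty, Set.mem_union,
    Set.mem_singleton_iff, Fin.ext_iff, not_or, and_imp]

theorem pair_injective (i : ℕ) (h : i + 1 < k) :
    Function.Injective ![(⟨i, by omega⟩ : Fin k), ⟨i + 1, h⟩] := by
  intro x y hxy
  fin_cases x <;> fin_cases y <;> simp_all

theorem matAt_mul (X Y : Matrix (Fin N) (Fin N) α) (i : ℕ) :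
    matAt N k (X * Y) i = matAt N k X i * matAt N k Y i := by
  by_cases h : i < k
  · rw [matAt_eq_embedAt _ _ h, matAt_eq_embedAt _ _ h, matAt_eq_embedAt _ _ h,
      ← embedAt_mul _ (Function.injective_of_subsingleton _)]
    exact congrArg _ (Matrix.submatrix_mul_equiv X Y _ (Equiv.funUnique (Fin 1) (Fin N)) _).symm
  · simp [matAt, h]

theorem opAt_mul (R T : Matrix (Fin N × Fin N) (Fin N × Fin N) α) (i : ℕ) :
    opAt N k (R * T) i = opAt N k R i * opAt N k T i := by
  by_cases h : i + 1 < k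
  · rw [opAt_eq_embedAt _ _ h, opAt_eq_embedAt _ _ h, opAt_eq_embedAt _ _ h,
      ← embedAt_mul _ (pair_injective i h), Matrix.submatrix_mul_equiv]
  · simp [opAt, h]

theorem opAt_one (i : ℕ) :
    opAt N k (1 : Matrix (Fin N × Fin N) (Fin N × Fin N) α) i = 1 := by
  by_cases h : i + 1 < k
  · rw [opAt_eq_embedAt _ _ h, Matrix.submatrix_one_equiv, embedAt_one]
  · simp [opAt, h]

/-- The embedding of `V^{⊗j}` as the tensor factors `s, …, s + j - 1` of `V^{⊗k}`. -/
def shiftFin {j k : ℕ} (s : ℕ) (h : s + j ≤ k) (i : Fin j) : Fin k := ⟨s + i, by omega⟩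

theorem shiftFin_injective {j k : ℕ} (s : ℕ) (h : s + j ≤ k) :
    Function.Injective (shiftFin s h) := by
  intro x y hxy
  simpa [shiftFin, Fin.ext_iff] using hxy

theorem embedAt_opAt {j : ℕ} (s : ℕ) (h : s + j ≤ k)
    (R : Matrix (Fin N × Fin N) (Fin N × Fin N) α) (i : ℕ) (hi : i + 1 < j) :
    embedAt (shiftFin s h) (opAt N j R i) = opAt N k R (s + i) := by
  rw [opAt_eq_embedAt _ _ hi, embedAt_comp _ (shiftFin_injective s h),
    opAt_eq_embedAt _ _ (by omega : s + i + 1 < k)]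
  congr 1
  funext x
  fin_cases x <;> simp [shiftFin, add_assoc]

theorem embedAt_matAt {j : ℕ} (s : ℕ) (h : s + j ≤ k)
    (X : Matrix (Fin N) (Fin N) α) (i : ℕ) (hi : i < j) :
    embedAt (shiftFin s h) (matAt N j X i) = matAt N k X (s + i) := by
  rw [matAt_eq_embedAt _ _ hi, embedAt_comp _ (shiftFin_injective s h),
    matAt_eq_embedAt _ _ (by omega : s + i < k)]
  rfl

theorem commute_opAt (R : Matrix (Fin N × Fin N) (Fin N × Fin N) α)
    (hR : ∀ a b c d, Commute (R a b) (R c d)) (i j : ℕ) (hij : i + 2 ≤ j) :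
    Commute (opAt N k R i) (opAt N k R j) := by
  by_cases h : j + 1 < k
  · rw [opAt_eq_embedAt _ _ (by omega : i + 1 < k), opAt_eq_embedAt _ _ h]
    refine commute_embedAt _ _ ?_ _ _ fun a b c d => hR _ _ _ _
    simp only [Matrix.range_cons, Matrix.range_empty, Set.union_empty, Set.disjoint_left]
    intro x hx hx'
    simp [Fin.ext_iff] at hx hx'
    omega
  · simp [opAt, h]

theorem commute_opAt_matAt (R : Matrix (Fin N × Fin N) (Fin N × Fin N) α)
    (X : Matrix (Fin N) (Fin N) α) (hRX : ∀ a b c d, Commute (R a b) (X c d))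
    (i j : ℕ) (hij : j < i) :
    Commute (opAt N k R i) (matAt N k X j) := by
  by_cases h : i + 1 < k
  · rw [opAt_eq_embedAt _ _ h, matAt_eq_embedAt _ _ (by omega : j < k)]
    refine commute_embedAt _ _ ?_ _ _ fun a b c d => hRX _ _ _ _
    simp only [Matrix.range_cons, Matrix.range_empty, Set.union_empty, Set.disjoint_left]
    intro x hx hx'
    simp [Fin.ext_iff] at hx hx'
    omega
  · simp [opAt, h]

theorem opAt_toA {A : Type*} [Semiring A] [Algebra ℂ A]
    (R : Matrix (Fin N × Fin N) (Fin N × Fin N) ℂ) (i : ℕ) :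
    opAt N k (toA A R) i = (algebraMap ℂ A).mapMatrix (opAt N k R i) := by
  by_cases h : i + 1 < k
  · ext a b
    simp only [opAt, dif_pos h, toA, RingHom.mapMatrix_apply, Matrix.map_apply, Matrix.of_apply]
    split_ifs <;> simp
  · simp only [opAt, dif_neg h, map_one]

theorem IsBraid.opAt_braid {R : Matrix (Fin N × Fin N) (Fin N × Fin N) ℂ} (hR : IsBraid N R)
    (p : ℕ) (hp : p + 2 < k) :
    opAt N k R p * opAt N k R (p + 1) * opAt N k R p =
      opAt N k R (p + 1) * opAt N k R p * opAt N k R (p + 1) := by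
  have hs : p + 3 ≤ k := hp
  have h := congrArg (embedAt (shiftFin p hs)) hR
  simpa [embedAt_mul _ (shiftFin_injective p hs), embedAt_opAt] using h

end Sites

/-- Under the homogeneous permutation relation
`D₁ R M₁ R = R M₁ R⁻¹ D₁`, with `L̂ = MD`, for all `n ≥ 2` and `1 ≤ m ≤ n − 1`:
`D_{⟨m⟩} L̂_{⟨n⟩} = L̂_{⟨n⟩} D_{⟨m⟩} · J_{n−m}^{↑m} · (J_{n−m+1}^{↑(m−1)})⁻¹`
(the normally ordered form `:D_{⟨m⟩} L̂_{⟨n⟩}:`). -/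
theorem stmt12 {A : Type*} [Ring A] [Algebra ℂ A] (N : ℕ) (hN : 1 ≤ N) (q : ℂ)
    (hq : GenericQ q)
    (R Rinv : Matrix (Fin N × Fin N) (Fin N × Fin N) ℂ)
    (hRinv : R * Rinv = 1 ∧ Rinv * R = 1)
    (hbraid : IsBraid N R) (hHecke : IsHecke N q R)
    (M D : Matrix (Fin N) (Fin N) A)
    (hM : RErel N (toA A R) M)
    (hD : RErel N (toA A Rinv) D)
    (hDM : PermRelHom N R Rinv M D)
    (n m : ℕ) (hn : 2 ≤ n) (hm : 1 ≤ m) (hmn : m ≤ n - 1) :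
    ovCopy N n (toA A R) (toA A Rinv) D (m - 1) *
        ovCopy N n (toA A R) (toA A Rinv) (M * D) (n - 1) =
      ovCopy N n (toA A R) (toA A Rinv) (M * D) (n - 1) *
        ovCopy N n (toA A R) (toA A Rinv) D (m - 1) *
        JMup N n (toA A R) m (n - m - 1) *
        JMup N n (toA A Rinv) (m - 1) (n - m) := by
  obtain ⟨p, rfl⟩ : ∃ p, m = p + 1 := ⟨m - 1, by omega⟩
  obtain ⟨t, rfl⟩ : ∃ t, n = p + t + 2 := ⟨n - p - 2, by omega⟩
  have h2 : 0 + 2 ≤ p + t + 2 := by omega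
  have htoA : ∀ X Y : Matrix (Fin N × Fin N) (Fin N × Fin N) ℂ, X * Y = 1 →
      toA A X * toA A Y = 1 := fun X Y h => by
    have := congrArg (algebraMap ℂ A).mapMatrix h
    rwa [map_mul, map_one] at this
  let r (i : ℕ) : (Matrix (Fin (p + t + 2) → Fin N) (Fin (p + t + 2) → Fin N) A)ˣ :=
    ⟨opAt N _ (toA A R) i, opAt N _ (toA A Rinv) i,
      by rw [← opAt_mul, htoA _ _ hRinv.1, opAt_one],
      by rw [← opAt_mul, htoA _ _ hRinv.2, opAt_one]⟩
  have hDk := congrArg (embedAt (shiftFin 0 h2)) hD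
  have hDMk := congrArg (embedAt (shiftFin 0 h2)) hDM
  simp only [embedAt_mul _ (shiftFin_injective 0 h2), embedAt_opAt _ _ _ 0 Nat.one_lt_two,
    embedAt_matAt _ _ _ 0 Nat.two_pos] at hDk hDMk
  have hcomm : ∀ X : Matrix (Fin N) (Fin N) A, ∀ i, 1 ≤ i →
      Commute (r i).val (matAt N _ X 0) := fun X i hi =>
    commute_opAt_matAt _ _ (fun _ _ _ _ => Algebra.commutes _ _) i 0 hi
  have key := copy_mul_copy (r := r) (k := p + t + 2)
    (D := ovCopy N _ (toA A R) (toA A Rinv) D)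
    (L := ovCopy N _ (toA A R) (toA A Rinv) (M * D))
    (fun i j h => commute_opAt _ (fun _ _ _ _ => Algebra.commutes _ _) i j h)
    (fun i hi => by
      have h := congrArg (algebraMap ℂ A).mapMatrix (hbraid.opAt_braid i hi)
      simp only [map_mul, ← opAt_toA] at h
      exact h)
    (fun _ => rfl) (hcomm D) (fun _ => rfl) (hcomm (M * D))
    (by
      have h := mul_conj_mul_of_perm (r 0) _ _ hDk hDMk
      rw [zero_add, ← matAt_mul] at h
      exact h)
    p (JMup N _ (toA A R) (p + 1)) (JMup N _ (toA A Rinv) p) rfl (fun _ => rfl) rfl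
    (fun _ => rfl) t (by omega)
  have e1 : p + t + 2 - 1 = p + t + 1 := by omega
  have e2 : p + t + 2 - (p + 1) - 1 = t := by omega
  have e3 : p + t + 2 - (p + 1) = t + 1 := by omega
  rw [e2, e3]
  exact key
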